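/- Lemma 4.2 (positivity of the regularized pair Hamiltonian): Fix ω ∈ ℝ, β ∈ (0,1), an even real-valued Schwartz function V on ℝ, N ≥ 1, and set α = ‖V‖²_{L¹(ℝ)}. For a Schwartz function ψ on ℝ² define H₁₂ ψ = S₁² ψ + S₂² ψ + ((N−1)/N) N^β V(N^β (x₁ − x₂)) ψ. Then for every Schwartz function ψ on ℝ², Re ⟨ψ, (H₁₂ + 2α) ψ⟩ ≥ ½ · Re ⟨ψ, (S₁² + S₂²) ψ⟩. -/

import Mathlib

open MeasureTheory Complex
open scoped BigOperators

noncomputable section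

/-- Second partial derivative `∂²_{x_j} ψ` of a function of `N` real variables. -/
def d2 {N : ℕ} (j : Fin N) (ψ : (Fin N → ℝ) → ℂ) : (Fin N → ℝ) → ℂ :=
  fun x => iteratedDeriv 2 (fun t => ψ (Function.update x j t)) (x j)

/-- The one-particle operator `S_j² ψ = ψ - ½ ∂²_{x_j} ψ + ½ ω² x_j² ψ`. -/
def Ssq {N : ℕ} (ω : ℝ) (j : Fin N) (ψ : (Fin N → ℝ) → ℂ) : (Fin N → ℝ) → ℂ :=
  fun x => ψ x - (1/2 : ℂ) * d2 j ψ x + (1/2 : ℂ) * (ω : ℂ) ^ 2 * ((x j : ℝ) : ℂ) ^ 2 * ψ x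

/-- The `N`-body Hamiltonian
`H_N ψ = Σ_j (-½ ∂²_{x_j} ψ + ½ ω² x_j² ψ)
  + (1/N) Σ_{i<j} N^β V(N^β (x_i - x_j)) ψ`. -/
def HamN (ω β : ℝ) (V : ℝ → ℝ) (N : ℕ) (ψ : (Fin N → ℝ) → ℂ) : (Fin N → ℝ) → ℂ :=
  fun x =>
    (∑ j : Fin N, (-(1/2 : ℂ) * d2 j ψ x + (1/2 : ℂ) * (ω : ℂ) ^ 2 * ((x j : ℝ) : ℂ) ^ 2 * ψ x))
    + ((N : ℂ))⁻¹ * ∑ p : Fin N × Fin N,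
        if p.1 < p.2 then
          (((N : ℝ) ^ β * V ((N : ℝ) ^ β * (x p.1 - x p.2)) : ℝ) : ℂ) * ψ x
        else 0

/-- `H_N + c·Id`. -/
def HamPlus (ω β : ℝ) (V : ℝ → ℝ) (N : ℕ) (c : ℝ) (ψ : (Fin N → ℝ) → ℂ) :
    (Fin N → ℝ) → ℂ :=
  fun x => HamN ω β V N ψ x + (c : ℂ) * ψ x

/-- The product `S₁² S₂² ⋯ S_k²` (composition of the pairwise commuting operators `S_j²`
for the first `k` coordinates). -/
def Sprod (ω : ℝ) (N : ℕ) : ℕ → ((Fin N → ℝ) → ℂ) → ((Fin N → ℝ) → ℂ)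
  | 0, ψ => ψ
  | (k+1), ψ => if h : k < N then Ssq ω ⟨k, h⟩ (Sprod ω N k ψ) else Sprod ω N k ψ

/-- The real part of the `L²(ℝ^N)` inner product `⟨ψ, f⟩ = ∫ conj(ψ) f`. -/
def reInner {N : ℕ} (ψ f : (Fin N → ℝ) → ℂ) : ℝ :=
  (∫ x : Fin N → ℝ, (starRingEnd ℂ) (ψ x) * f x).re

/-- A function of `N` variables is symmetric if it is invariant under permutations of its
arguments. -/
def IsSymmetricFn {N : ℕ} (ψ : (Fin N → ℝ) → ℂ) : Prop :=
  ∀ (σ : Equiv.Perm (Fin N)) (x : Fin N → ℝ), ψ (x ∘ σ) = ψ x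

namespace PairHamiltonian

open SchwartzMap LineDeriv
open scoped SchwartzMap LineDeriv

/-- Slicing a Schwartz function in one coordinate direction gives its line derivative. -/
lemma hasDerivAt_update {n : ℕ} (j : Fin n) (φ : 𝓢(Fin n → ℝ, ℂ)) (x : Fin n → ℝ) (t : ℝ) :
    HasDerivAt (fun s => φ (Function.update x j s))
      ((∂_{(Pi.single j (1 : ℝ) : Fin n → ℝ)} φ) (Function.update x j t)) t := by
  rw [lineDerivOp_apply_eq_fderiv]
  exact (φ.hasFDerivAt _).comp_hasDerivAt t (_root_.hasDerivAt_update x j t)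

lemma d2_eq_lineDerivOp {n : ℕ} (j : Fin n) (φ : 𝓢(Fin n → ℝ, ℂ)) (x : Fin n → ℝ) :
    d2 j φ x = (∂_{(Pi.single j (1 : ℝ) : Fin n → ℝ)} (∂_{(Pi.single j (1 : ℝ) : Fin n → ℝ)} φ)) x := by
  have h1 : deriv (fun s => φ (Function.update x j s)) =
      fun t => (∂_{(Pi.single j (1 : ℝ) : Fin n → ℝ)} φ) (Function.update x j t) :=
    funext fun t => (hasDerivAt_update j φ x t).deriv
  rw [d2, iteratedDeriv_succ, iteratedDeriv_one, h1, (hasDerivAt_update j _ x _).deriv,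
    Function.update_eq_self]

lemma hasTemperateGrowth_coord_sq {n : ℕ} (j : Fin n) :
    (fun x : Fin n → ℝ => (x j) ^ 2).HasTemperateGrowth :=
  ((ContinuousLinearMap.proj (R := ℝ) (φ := fun _ : Fin n => ℝ) j).hasTemperateGrowth).pow 2

/-- `S_j²` acting on Schwartz functions. -/
def ssq {n : ℕ} (ω : ℝ) (j : Fin n) (φ : 𝓢(Fin n → ℝ, ℂ)) : 𝓢(Fin n → ℝ, ℂ) :=
  φ - (1 / 2 : ℝ) • ∂_{(Pi.single j (1 : ℝ) : Fin n → ℝ)} (∂_{(Pi.single j (1 : ℝ) : Fin n → ℝ)} φ)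
    + (ω ^ 2 / 2 : ℝ) • smulLeftCLM ℂ (fun x : Fin n → ℝ => (x j) ^ 2) φ

lemma ssq_apply {n : ℕ} (ω : ℝ) (j : Fin n) (φ : 𝓢(Fin n → ℝ, ℂ)) (x : Fin n → ℝ) :
    ssq ω j φ x = Ssq ω j φ x := by
  simp only [ssq, Ssq, d2_eq_lineDerivOp, add_apply, sub_apply,
    smul_apply, smulLeftCLM_apply_apply (hasTemperateGrowth_coord_sq j), Complex.real_smul]
  push_cast
  ring

lemma integrable_bilin {n : ℕ} {E F G : Type*} [NormedAddCommGroup E] [NormedSpace ℝ E]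
    [NormedAddCommGroup F] [NormedSpace ℝ F] [NormedAddCommGroup G] [NormedSpace ℝ G]
    (L : E →L[ℝ] F →L[ℝ] G) (φ : 𝓢(Fin n → ℝ, E)) (χ : 𝓢(Fin n → ℝ, F)) :
    Integrable (fun x => L (φ x) (χ x)) :=
  (bilinLeftCLM L χ.hasTemperateGrowth φ).integrable

lemma integrable_inner {n : ℕ} (φ χ : 𝓢(Fin n → ℝ, ℂ)) :
    Integrable (fun x => inner ℝ (φ x) (χ x)) :=
  integrable_bilin (innerSL ℝ) φ χ

lemma integrable_norm_sq {n : ℕ} (φ : 𝓢(Fin n → ℝ, ℂ)) :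
    Integrable (fun x => ‖φ x‖ ^ 2) := by
  simpa only [real_inner_self_eq_norm_sq] using integrable_inner φ φ

lemma integral_inner_ssq_ge {n : ℕ} (ω : ℝ) (j : Fin n) (φ : 𝓢(Fin n → ℝ, ℂ)) :
    (∫ x, ‖φ x‖ ^ 2) + (1 / 2) * ∫ x, ‖(∂_{(Pi.single j (1 : ℝ) : Fin n → ℝ)} φ) x‖ ^ 2 ≤
      ∫ x, inner ℝ (φ x) (ssq ω j φ x) := by
  set v : Fin n → ℝ := Pi.single j 1
  set χ := smulLeftCLM ℂ (fun x : Fin n → ℝ => (x j) ^ 2) φ with hχ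
  have hparts : ∫ x, inner ℝ (φ x) ((∂_{v} (∂_{v} φ)) x) = -∫ x, ‖(∂_{v} φ) x‖ ^ 2 := by
    have h : ∫ x, inner ℝ (φ x) ((∂_{v} (∂_{v} φ)) x) =
        -∫ x, inner ℝ ((∂_{v} φ) x) ((∂_{v} φ) x) :=
      integral_bilinear_lineDerivOp_right_eq_neg_left φ (∂_{v} φ) (innerSL ℝ) v
    simpa only [real_inner_self_eq_norm_sq] using h
  have hpot : 0 ≤ ∫ x, inner ℝ (φ x) (χ x) := by
    refine integral_nonneg fun x => ?_
    simp only [hχ, smulLeftCLM_apply_apply (hasTemperateGrowth_coord_sq j), inner_smul_right,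
      real_inner_self_eq_norm_sq, Pi.zero_apply]
    positivity
  have hsum : ∫ x, inner ℝ (φ x) (ssq ω j φ x) = (∫ x, ‖φ x‖ ^ 2) -
      (1 / 2) * (∫ x, inner ℝ (φ x) ((∂_{v} (∂_{v} φ)) x)) +
      (ω ^ 2 / 2) * ∫ x, inner ℝ (φ x) (χ x) := by
    have hsub : Integrable
        (fun x => ‖φ x‖ ^ 2 - 1 / 2 * inner ℝ (φ x) ((∂_{v} (∂_{v} φ)) x)) :=
      (integrable_norm_sq φ).sub ((integrable_inner _ _).const_mul _)
    rw [← integral_const_mul, ← integral_const_mul, ← integral_sub (integrable_norm_sq φ)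
      ((integrable_inner _ _).const_mul _),
      ← integral_add hsub ((integrable_inner _ _).const_mul _)]
    refine integral_congr_ae (.of_forall fun x => ?_)
    simp only [ssq, add_apply, sub_apply, smul_apply,
      inner_add_right, inner_sub_right, real_inner_smul_right, real_inner_self_eq_norm_sq]
    rfl
  rw [hsum, hparts]
  nlinarith [mul_nonneg (by positivity : 0 ≤ ω ^ 2 / 2) hpot]

lemma reInner_eq_integral_inner {n : ℕ} {φ f : (Fin n → ℝ) → ℂ}
    (h : Integrable (fun x => (starRingEnd ℂ) (φ x) * f x)) :
    reInner φ f = ∫ x, inner ℝ (φ x) (f x) := by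
  rw [reInner, ← reCLM_apply, ← ContinuousLinearMap.integral_comp_comm _ h]
  simp only [reCLM_apply, Complex.inner, mul_comm]

lemma integrable_conj_mul {n : ℕ} (φ χ : 𝓢(Fin n → ℝ, ℂ)) :
    Integrable (fun x => (starRingEnd ℂ) (φ x) * χ x) :=
  integrable_bilin ((ContinuousLinearMap.mul ℝ ℂ).comp
    (conjCLE : ℂ →L[ℝ] ℂ)) φ χ

lemma abs_primitive_le {V : ℝ → ℝ} (hV : Integrable V) (heven : ∀ x, V (-x) = V x) (t : ℝ) :
    |∫ y in (0 : ℝ)..t, V y| ≤ (∫ y, |V y|) / 2 := by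
  have hI (a b : ℝ) : IntervalIntegrable (fun y => |V y|) volume a b :=
    hV.abs.intervalIntegrable
  have hneg (s : ℝ) : ∫ y in (-s)..0, |V y| = ∫ y in (0 : ℝ)..s, |V y| := by
    have := intervalIntegral.integral_comp_neg (fun y => |V y|) (a := 0) (b := s)
    simpa only [heven, neg_zero] using this.symm
  have hpos {s : ℝ} (hs : 0 ≤ s) : ∫ y in (0 : ℝ)..s, |V y| ≤ (∫ y, |V y|) / 2 := by
    have hadd := intervalIntegral.integral_add_adjacent_intervals (hI (-s) 0) (hI 0 s)
    have hle : ∫ y in (-s)..s, |V y| ≤ ∫ y, |V y| := by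
      rw [intervalIntegral.integral_of_le (by linarith)]
      exact setIntegral_le_integral hV.abs (.of_forall fun _ => abs_nonneg _)
    linarith [hneg s]
  rcases le_total 0 t with ht | ht
  · exact (intervalIntegral.abs_integral_le_integral_abs ht).trans (hpos ht)
  · rw [intervalIntegral.integral_symm, abs_neg]
    refine (intervalIntegral.abs_integral_le_integral_abs ht).trans ?_
    have := hneg (-t)
    rw [neg_neg] at this
    exact this.trans_le (hpos (by linarith))

/-- If a bounded potential `W` is the derivative along `v` of a function bounded by `a / 2`, then
it is form bounded by the kinetic energy in the direction `v`. -/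
lemma neg_le_integral_mul_norm_sq {n : ℕ} (φ : 𝓢(Fin n → ℝ, ℂ)) (v : Fin n → ℝ)
    {g W : (Fin n → ℝ) → ℝ} {a : ℝ} (hgc : Continuous g)
    (hga : ∀ x, |g x| ≤ a / 2) (hgW : ∀ x, HasLineDerivAt ℝ g (W x) x v)
    (hWi : Integrable (fun x => W x * ‖φ x‖ ^ 2)) :
    -((1 / 4) * (∫ x, ‖(∂_{v} φ) x‖ ^ 2) + a ^ 2 * ∫ x, ‖φ x‖ ^ 2) ≤
      ∫ x, W x * ‖φ x‖ ^ 2 := by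
  have hder (x) : HasLineDerivAt ℝ (fun x => ‖φ x‖ ^ 2) (2 * inner ℝ (φ x) ((∂_{v} φ) x)) x v := by
    have := ((φ.hasFDerivAt x).hasLineDerivAt v)
    rw [← lineDerivOp_apply_eq_fderiv] at this
    unfold HasLineDerivAt at this ⊢
    simpa using this.norm_sq
  have hgi (f : (Fin n → ℝ) → ℝ) (hf : Integrable f) : Integrable (fun x => g x * f x) :=
    hf.bdd_mul hgc.aestronglyMeasurable (.of_forall hga)
  have hgin : Integrable (fun x => g x * (2 * inner ℝ (φ x) ((∂_{v} φ) x))) :=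
    hgi _ ((integrable_inner _ _).const_mul 2)
  have hip : ∫ x, g x * (2 * inner ℝ (φ x) ((∂_{v} φ) x)) = -∫ x, W x * ‖φ x‖ ^ 2 := by
    have h := integral_bilinear_hasLineDerivAt_right_eq_neg_left_of_integrable
      (μ := (volume : Measure (Fin n → ℝ))) (B := ContinuousLinearMap.mul ℝ ℝ) (v := v)
      (f := g) (f' := W) (g := fun x => ‖φ x‖ ^ 2)
      (g' := fun x => 2 * inner ℝ (φ x) ((∂_{v} φ) x))
    simp only [ContinuousLinearMap.mul_apply'] at h
    exact h hWi hgin (hgi _ (integrable_norm_sq φ)) (fun x _ => hgW x) (fun x _ => hder x)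
  rw [← integral_const_mul, ← integral_const_mul, ← integral_add
    ((integrable_norm_sq _).const_mul _) ((integrable_norm_sq _).const_mul _), neg_le, ← hip]
  refine integral_mono hgin
    (((integrable_norm_sq _).const_mul _).add ((integrable_norm_sq _).const_mul _)) fun x => ?_
  have h1 := abs_real_inner_le_norm (φ x) ((∂_{v} φ) x)
  have h2 : g x * (2 * inner ℝ (φ x) ((∂_{v} φ) x)) ≤ a * (‖φ x‖ * ‖(∂_{v} φ) x‖) := by
    refine (le_abs_self _).trans ?_
    rw [abs_mul, abs_mul, abs_two]
    have := mul_le_mul (hga x) h1 (abs_nonneg _) ((abs_nonneg _).trans (hga x))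
    linarith
  refine h2.trans ?_
  nlinarith [sq_nonneg (‖(∂_{v} φ) x‖ / 2 - a * ‖φ x‖)]

end PairHamiltonian

open PairHamiltonian LineDeriv SchwartzMap

/-- **Lemma 4.2** (positivity of the regularized pair Hamiltonian): with `α = ‖V‖²_{L¹}` and
`H₁₂ ψ = S₁² ψ + S₂² ψ + ((N-1)/N) N^β V(N^β (x₁ - x₂)) ψ` on `ℝ²`,
`Re ⟨ψ, (H₁₂ + 2α) ψ⟩ ≥ ½ Re ⟨ψ, (S₁² + S₂²) ψ⟩` for every Schwartz `ψ` on `ℝ²`. -/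
theorem pair_hamiltonian_positivity (ω β : ℝ) (hβ0 : 0 < β) (hβ1 : β < 1)
    (V : SchwartzMap ℝ ℝ) (hVeven : ∀ x : ℝ, V (-x) = V x)
    (N : ℕ) (hN : 1 ≤ N) (ψ : SchwartzMap (Fin 2 → ℝ) ℂ) :
    (1/2 : ℝ) * reInner ⇑ψ (fun x => Ssq ω (0 : Fin 2) ⇑ψ x + Ssq ω (1 : Fin 2) ⇑ψ x)
      ≤ reInner ⇑ψ (fun x =>
          (Ssq ω (0 : Fin 2) ⇑ψ x + Ssq ω (1 : Fin 2) ⇑ψ x +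
            (((((N : ℝ) - 1) / N) * (N : ℝ) ^ β * V ((N : ℝ) ^ β * (x 0 - x 1)) : ℝ) : ℂ)
              * ψ x)
          + ((2 * (∫ y : ℝ, |V y|) ^ 2 : ℝ) : ℂ) * ψ x) := by
  set v : Fin 2 → ℝ := Pi.single 0 1 with hv
  set a : ℝ := ∫ y, |V y|
  set L : ℝ := (N : ℝ) ^ β
  set c : ℝ := ((N : ℝ) - 1) / N
  have hN' : (1 : ℝ) ≤ N := by exact_mod_cast hN
  have hc0 : 0 ≤ c := div_nonneg (by linarith) (by linarith)
  have hc1 : c ≤ 1 := div_le_one_of_le₀ (by linarith) (by linarith)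
  set W : (Fin 2 → ℝ) → ℝ := fun x => c * L * V (L * (x 0 - x 1)) with hW
  set T : 𝓢(Fin 2 → ℝ, ℂ) := ssq ω 0 ψ + ssq ω 1 ψ with hT
  have hTx (x) : Ssq ω 0 ψ x + Ssq ω 1 ψ x = T x := by
    rw [hT, add_apply, ssq_apply, ssq_apply]
  have hWc : Continuous W := by
    have := V.continuous
    fun_prop
  obtain ⟨C, hC⟩ : ∃ C, ∀ x, ‖W x‖ ≤ C := by
    obtain ⟨C, -, hC⟩ := V.decay 0 0
    refine ⟨|c * L| * C, fun x => ?_⟩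
    rw [Real.norm_eq_abs, hW, abs_mul]
    refine mul_le_mul_of_nonneg_left ?_ (abs_nonneg _)
    simpa using hC (L * (x 0 - x 1))
  have hWi : Integrable (fun x => W x * ‖ψ x‖ ^ 2) :=
    (integrable_norm_sq ψ).bdd_mul hWc.aestronglyMeasurable (.of_forall hC)
  have hprim (t : ℝ) : HasDerivAt (fun t => ∫ y in (0 : ℝ)..t, V y) (V t) t :=
    V.continuous.integral_hasStrictDerivAt 0 t |>.hasDerivAt
  have hlower := neg_le_integral_mul_norm_sq ψ v
    (g := fun x => c * ∫ y in (0 : ℝ)..(L * (x 0 - x 1)), V y) (W := W) (a := a)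
    (by
      have hp : Continuous (fun t => ∫ y in (0 : ℝ)..t, V y) :=
        continuous_iff_continuousAt.2 fun t => (hprim t).continuousAt
      exact continuous_const.mul (hp.comp (by fun_prop)))
    (fun x => by
      rw [abs_mul, abs_of_nonneg hc0]
      exact (mul_le_of_le_one_left (abs_nonneg _) hc1).trans
        (abs_primitive_le V.integrable hVeven _))
    (fun x => by
      have hlin : HasDerivAt (fun t : ℝ => L * ((x + t • v) 0 - (x + t • v) 1)) L 0 := by
        simpa [hv] using (((hasDerivAt_id (0 : ℝ)).const_add (x 0)).sub_const (x 1)).const_mul L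
      have := (((hprim _).comp (0 : ℝ) hlin).const_mul c)
      unfold HasLineDerivAt
      convert! this using 1
      simp only [hW, zero_smul, add_zero]
      ring)
    hWi
  have hkin : (∫ x, ‖ψ x‖ ^ 2) + (∫ x, ‖ψ x‖ ^ 2) + (1 / 2) * (∫ x, ‖(∂_{v} ψ) x‖ ^ 2) ≤
      ∫ x, inner ℝ (ψ x) (T x) := by
    simp only [hT, add_apply, inner_add_right]
    rw [integral_add (integrable_inner _ _) (integrable_inner _ _)]
    have h0 := integral_inner_ssq_ge ω 0 ψ
    have h1 := integral_inner_ssq_ge ω 1 ψ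
    have : 0 ≤ ∫ x, ‖(∂_{(Pi.single 1 (1 : ℝ) : Fin 2 → ℝ)} ψ) x‖ ^ 2 :=
      integral_nonneg fun _ => by positivity
    linarith
  have hψ : 0 ≤ ∫ x, ‖ψ x‖ ^ 2 := integral_nonneg fun _ => by positivity
  simp only [hTx]
  have hmulint {w : (Fin 2 → ℝ) → ℝ} (hw : Integrable (fun x => w x * ‖ψ x‖ ^ 2)) :
      Integrable (fun x => (starRingEnd ℂ) (ψ x) * ((w x : ℂ) * ψ x)) := by
    refine hw.ofReal.congr (.of_forall fun x => ?_)
    simp only [RCLike.ofReal_mul, RCLike.ofReal_pow]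
    rw [mul_left_comm, Complex.conj_mul']
    rfl
  have hrhs : Integrable (fun x => (starRingEnd ℂ) (ψ x) *
      (T x + (W x : ℂ) * ψ x + ((2 * a ^ 2 : ℝ) : ℂ) * ψ x)) := by
    simp only [mul_add]
    exact ((integrable_conj_mul ψ T).add (hmulint hWi)).add
      (hmulint ((integrable_norm_sq ψ).const_mul _))
  rw [reInner_eq_integral_inner (integrable_conj_mul ψ T), reInner_eq_integral_inner hrhs]
  simp only [← Complex.real_smul, inner_add_right, real_inner_smul_right,
    real_inner_self_eq_norm_sq]
  have hTW : Integrable (fun x => inner ℝ (ψ x) (T x) + W x * ‖ψ x‖ ^ 2) :=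
    (integrable_inner _ _).add hWi
  rw [integral_add hTW ((integrable_norm_sq ψ).const_mul _),
    integral_add (integrable_inner _ _) hWi, integral_const_mul]
  nlinarith [mul_nonneg (sq_nonneg a) hψ]

end
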